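/- The pullback under φ_0 : P^n × P^n → P(Sym^3(W)), ([λ],[μ]) ↦ [λμ²], of the ideal sheaf of the triple-hyperplane locus B_0 equals the square I(Δ)² of the ideal sheaf of the diagonal Δ ⊆ P^n × P^n. Concretely, in the affine charts above, substituting the coefficients of λμ² into the generators f_J of I(B_0) yields polynomials generating the square of the ideal (λ_1 - μ_1, ..., λ_n - μ_n). -/

import Mathlib

open MvPolynomial

/-- The universal non-reduced cubic `λμ²` with
`λ = x₀ + λ₁x₁ + ⋯ + λₙxₙ`, `μ = x₀ + μ₁x₁ + ⋯ + μₙxₙ`, over the coordinate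
ring of the affine chart of `Pⁿ × Pⁿ` (variables `Sum.inl i = λᵢ`,
`Sum.inr i = μᵢ`). -/
noncomputable def universalCubic (k : Type*) [CommRing k] (n : ℕ) :
    MvPolynomial (Fin (n + 1)) (MvPolynomial (Fin n ⊕ Fin n) k) :=
  (X 0 + ∑ i : Fin n, C (X (Sum.inl i)) * X i.succ) *
    (X 0 + ∑ i : Fin n, C (X (Sum.inr i)) * X i.succ) ^ 2

/-- The coefficient `a_{ijl}` (on the monomial `xᵢxⱼx_l`) of the universal
non-reduced cubic, as a polynomial in `λ₁,…,λₙ,μ₁,…,μₙ`. -/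
noncomputable def universalCoeff (k : Type*) [CommRing k] (n : ℕ)
    (i j l : Fin (n + 1)) : MvPolynomial (Fin n ⊕ Fin n) k :=
  MvPolynomial.coeff (Finsupp.single i 1 + Finsupp.single j 1 + Finsupp.single l 1)
    (universalCubic k n)

/-- Coefficients of the product of a linear form with a polynomial. -/
lemma coeff_linearForm_mul {R σ : Type*} [CommRing R] [Fintype σ] [DecidableEq σ]
    (a : σ → R) (P : MvPolynomial σ R) (m : σ →₀ ℕ) :
    coeff m ((∑ s, C (a s) * X s) * P) =
      ∑ s ∈ m.support, a s * coeff (m - Finsupp.single s 1) P := by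
  rw [Finset.sum_mul, coeff_sum,
    ← Finset.sum_subset (Finset.subset_univ m.support)]
  · refine Finset.sum_congr rfl fun s hs => ?_
    rw [mul_assoc, coeff_C_mul, mul_comm (X s), coeff_mul_X', if_pos hs]
  · intro s _ hs
    rw [mul_assoc, coeff_C_mul, mul_comm (X s), coeff_mul_X', if_neg hs, mul_zero]

lemma coeff_single_linearForm {R σ : Type*} [CommRing R] [Fintype σ] [DecidableEq σ]
    (a : σ → R) (i : σ) :
    coeff (Finsupp.single i 1) (∑ s, C (a s) * X s) = a i := by
  have h := coeff_linearForm_mul a 1 (Finsupp.single i 1)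
  simpa [Finsupp.support_single] using h

section ProductOfLinearForms

variable {R σ : Type*} [CommRing R] [Fintype σ] [DecidableEq σ] (a b c : σ → R)

lemma coeff_linearForm_mul_self (i : σ) :
    coeff (Finsupp.single i 1 + Finsupp.single i 1)
      ((∑ s, C (a s) * X s) * (∑ s, C (b s) * X s)) = a i * b i := by
  have hs : (Finsupp.single i 1 + Finsupp.single i 1 : σ →₀ ℕ).support = {i} := by
    ext s; simp [Finsupp.single_apply, eq_comm]
  rw [coeff_linearForm_mul, hs, Finset.sum_singleton, add_tsub_cancel_right,
    coeff_single_linearForm]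

lemma coeff_linearForm_mul_of_ne {i j : σ} (hij : i ≠ j) :
    coeff (Finsupp.single i 1 + Finsupp.single j 1)
      ((∑ s, C (a s) * X s) * (∑ s, C (b s) * X s)) = a i * b j + a j * b i := by
  have hs : (Finsupp.single i 1 + Finsupp.single j 1 : σ →₀ ℕ).support = {i, j} := by
    ext s; simp [Finsupp.single_apply, eq_comm]; tauto
  rw [coeff_linearForm_mul, hs, Finset.sum_pair hij, add_tsub_cancel_right,
    add_tsub_cancel_left, coeff_single_linearForm, coeff_single_linearForm]

lemma coeff_linearForm_mul_mul_self (i : σ) :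
    coeff (Finsupp.single i 1 + Finsupp.single i 1 + Finsupp.single i 1)
      ((∑ s, C (a s) * X s) * ((∑ s, C (b s) * X s) * (∑ s, C (c s) * X s))) =
      a i * (b i * c i) := by
  have hs : (Finsupp.single i 1 + Finsupp.single i 1 + Finsupp.single i 1 : σ →₀ ℕ).support
      = {i} := by
    ext s; simp [Finsupp.single_apply, eq_comm]
  rw [coeff_linearForm_mul, hs, Finset.sum_singleton, add_tsub_cancel_right,
    coeff_linearForm_mul_self]

lemma coeff_linearForm_mul_mul_of_ne {i j : σ} (hij : i ≠ j) :
    coeff (Finsupp.single i 1 + Finsupp.single i 1 + Finsupp.single j 1)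
      ((∑ s, C (a s) * X s) * ((∑ s, C (b s) * X s) * (∑ s, C (c s) * X s))) =
      a i * (b i * c j + b j * c i) + a j * (b i * c i) := by
  have hs : (Finsupp.single i 1 + Finsupp.single i 1 + Finsupp.single j 1 : σ →₀ ℕ).support
      = {i, j} := by
    ext s; simp [Finsupp.single_apply, eq_comm]; tauto
  rw [coeff_linearForm_mul, hs, Finset.sum_pair hij, add_tsub_cancel_right,
    add_assoc, add_tsub_cancel_left, coeff_linearForm_mul_of_ne b c hij,
    coeff_linearForm_mul_self]

lemma coeff_linearForm_mul_mul_of_ne_of_ne {i j l : σ} (hij : i ≠ j) (hil : i ≠ l)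
    (hjl : j ≠ l) :
    coeff (Finsupp.single i 1 + Finsupp.single j 1 + Finsupp.single l 1)
      ((∑ s, C (a s) * X s) * ((∑ s, C (b s) * X s) * (∑ s, C (c s) * X s))) =
      a i * (b j * c l + b l * c j) + a j * (b i * c l + b l * c i) +
        a l * (b i * c j + b j * c i) := by
  have hs : (Finsupp.single i 1 + Finsupp.single j 1 + Finsupp.single l 1 : σ →₀ ℕ).support
      = {i, j, l} := by
    ext s; simp [Finsupp.single_apply, eq_comm]; tauto
  have hi : (Finsupp.single i 1 + Finsupp.single j 1 + Finsupp.single l 1 : σ →₀ ℕ) -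
      Finsupp.single i 1 = Finsupp.single j 1 + Finsupp.single l 1 := by
    rw [add_assoc, add_tsub_cancel_left]
  have hj : (Finsupp.single i 1 + Finsupp.single j 1 + Finsupp.single l 1 : σ →₀ ℕ) -
      Finsupp.single j 1 = Finsupp.single i 1 + Finsupp.single l 1 := by
    rw [add_right_comm, add_tsub_cancel_right]
  rw [coeff_linearForm_mul, hs, Finset.sum_insert (by simp [hij, hil]), Finset.sum_pair hjl,
    hi, hj, add_tsub_cancel_right, coeff_linearForm_mul_of_ne b c hjl,
    coeff_linearForm_mul_of_ne b c hil, coeff_linearForm_mul_of_ne b c hij, add_assoc]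

end ProductOfLinearForms

section UniversalCoeff

variable (k : Type*) [CommRing k] (n : ℕ)

/-- The universal cubic as a product of homogeneous linear forms with leading coefficient `1`. -/
lemma universalCubic_eq :
    universalCubic k n =
      (∑ s, C ((Fin.cons 1 fun i => X (Sum.inl i) :
          Fin (n + 1) → MvPolynomial (Fin n ⊕ Fin n) k) s) * X s) *
        ((∑ s, C ((Fin.cons 1 fun i => X (Sum.inr i) :
            Fin (n + 1) → MvPolynomial (Fin n ⊕ Fin n) k) s) * X s) *
          (∑ s, C ((Fin.cons 1 fun i => X (Sum.inr i) :
            Fin (n + 1) → MvPolynomial (Fin n ⊕ Fin n) k) s) * X s)) := by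
  simp [universalCubic, Fin.sum_univ_succ, sq]

lemma universalCoeff_zero_zero_succ (i : Fin n) :
    universalCoeff k n 0 0 i.succ = X (Sum.inl i) + 2 * X (Sum.inr i) := by
  rw [universalCoeff, universalCubic_eq,
    coeff_linearForm_mul_mul_of_ne _ _ _ (Fin.succ_ne_zero i).symm]
  simp only [Fin.cons_zero, Fin.cons_succ]
  ring

lemma universalCoeff_succ_self (i : Fin n) :
    universalCoeff k n i.succ i.succ i.succ = X (Sum.inl i) * X (Sum.inr i) ^ 2 := by
  rw [universalCoeff, universalCubic_eq, coeff_linearForm_mul_mul_self]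
  simp only [Fin.cons_succ]
  ring

lemma universalCoeff_zero_succ_self (i : Fin n) :
    universalCoeff k n 0 i.succ i.succ =
      2 * X (Sum.inl i) * X (Sum.inr i) + X (Sum.inr i) ^ 2 := by
  rw [universalCoeff, universalCubic_eq, add_assoc,
    add_comm (Finsupp.single 0 1),
    coeff_linearForm_mul_mul_of_ne _ _ _ (Fin.succ_ne_zero i)]
  simp only [Fin.cons_zero, Fin.cons_succ]
  ring

lemma universalCoeff_zero_succ_succ {i j : Fin n} (hij : i ≠ j) :
    universalCoeff k n 0 i.succ j.succ =
      2 * (X (Sum.inr i) * X (Sum.inr j) + X (Sum.inl i) * X (Sum.inr j) +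
        X (Sum.inl j) * X (Sum.inr i)) := by
  rw [universalCoeff, universalCubic_eq,
    coeff_linearForm_mul_mul_of_ne_of_ne _ _ _ (Fin.succ_ne_zero i).symm
      (Fin.succ_ne_zero j).symm ((Fin.succ_injective n).ne hij)]
  simp only [Fin.cons_zero, Fin.cons_succ]
  ring

lemma universalCoeff_succ_self_succ {i j : Fin n} (hij : i ≠ j) :
    universalCoeff k n i.succ i.succ j.succ =
      2 * X (Sum.inl i) * X (Sum.inr i) * X (Sum.inr j) +
        X (Sum.inl j) * X (Sum.inr i) ^ 2 := by
  rw [universalCoeff, universalCubic_eq,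
    coeff_linearForm_mul_mul_of_ne _ _ _ ((Fin.succ_injective n).ne hij)]
  simp only [Fin.cons_succ]
  ring

lemma universalCoeff_succ_succ_succ {i j l : Fin n} (hij : i ≠ j) (hil : i ≠ l)
    (hjl : j ≠ l) :
    universalCoeff k n i.succ j.succ l.succ =
      2 * (X (Sum.inl i) * X (Sum.inr j) * X (Sum.inr l) +
        X (Sum.inl j) * X (Sum.inr i) * X (Sum.inr l) +
        X (Sum.inl l) * X (Sum.inr i) * X (Sum.inr j)) := by
  rw [universalCoeff, universalCubic_eq,
    coeff_linearForm_mul_mul_of_ne_of_ne _ _ _ ((Fin.succ_injective n).ne hij)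
      ((Fin.succ_injective n).ne hil) ((Fin.succ_injective n).ne hjl)]
  simp only [Fin.cons_succ]
  ring

end UniversalCoeff

/-- The pullback under `φ₀ : ([λ],[μ]) ↦ [λμ²]` of the ideal
of the triple-hyperplane locus `B₀` equals the square of the ideal of the
diagonal: substituting the coefficients of `λμ²` into the generators `f_J` of
`I(B₀)` yields generators of `(λ₁ - μ₁, …, λₙ - μₙ)²`. -/
theorem pullback_B0_ideal_eq_diagonal_sq {k : Type*} [Field k] [CharZero k]
    (n : ℕ) (hn : 2 ≤ n) :
    Ideal.span {p : MvPolynomial (Fin n ⊕ Fin n) k |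
        (∃ i : Fin (n + 1), i ≠ 0 ∧
          p = 3 * universalCoeff k n 0 i i - (universalCoeff k n 0 0 i) ^ 2) ∨
        (∃ i j : Fin (n + 1), 0 < i ∧ i < j ∧
          p = 3 * universalCoeff k n 0 i j -
            2 * universalCoeff k n 0 0 i * universalCoeff k n 0 0 j) ∨
        (∃ i : Fin (n + 1), i ≠ 0 ∧
          p = 9 * universalCoeff k n i i i -
            universalCoeff k n 0 0 i * universalCoeff k n 0 i i) ∨
        (∃ i j : Fin (n + 1), i ≠ 0 ∧ j ≠ 0 ∧ i ≠ j ∧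
          p = 3 * universalCoeff k n i i j -
            universalCoeff k n 0 i i * universalCoeff k n 0 0 j) ∨
        (∃ i j l : Fin (n + 1), 0 < i ∧ i < j ∧ j < l ∧
          p = 3 * universalCoeff k n i j l -
            universalCoeff k n 0 i j * universalCoeff k n 0 0 l)} =
      (Ideal.span (Set.range fun i : Fin n =>
        (X (Sum.inl i) - X (Sum.inr i) : MvPolynomial (Fin n ⊕ Fin n) k))) ^ 2 := by
  set u : Fin n → MvPolynomial (Fin n ⊕ Fin n) k :=
    fun i => X (Sum.inl i) - X (Sum.inr i) with hu
  apply le_antisymm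
  · have hmem : ∀ i j, u i * u j ∈ Ideal.span (Set.range u) ^ 2 := fun i j => by
      rw [sq]
      exact Ideal.mul_mem_mul (Ideal.subset_span ⟨i, rfl⟩) (Ideal.subset_span ⟨j, rfl⟩)
    rw [Ideal.span_le]
    refine fun p hp => SetLike.mem_coe.2 ?_
    rcases hp with (⟨i, hi, rfl⟩ | ⟨i, j, hi, hij, rfl⟩ | ⟨i, hi, rfl⟩ | ⟨i, j, hi, hj, hij, rfl⟩ |
      ⟨i, j, l, hi, hij, hjl, rfl⟩)
    · obtain ⟨i, rfl⟩ := Fin.exists_succ_eq.2 hi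
      rw [universalCoeff_zero_succ_self, universalCoeff_zero_zero_succ]
      convert Ideal.mul_mem_left _ (-1) (hmem i i) using 1
      simp only [hu]
      ring
    · obtain ⟨j, rfl⟩ := Fin.exists_succ_eq.2 (hi.trans hij).ne'
      obtain ⟨i, rfl⟩ := Fin.exists_succ_eq.2 hi.ne'
      rw [universalCoeff_zero_succ_succ k n (Fin.succ_lt_succ_iff.1 hij).ne,
        universalCoeff_zero_zero_succ, universalCoeff_zero_zero_succ]
      convert Ideal.mul_mem_left _ (-2) (hmem i j) using 1
      simp only [hu]
      ring
    · obtain ⟨i, rfl⟩ := Fin.exists_succ_eq.2 hi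
      rw [universalCoeff_succ_self, universalCoeff_zero_succ_self, universalCoeff_zero_zero_succ]
      convert Ideal.mul_mem_left _ (-2 * X (Sum.inr i)) (hmem i i) using 1
      simp only [hu]
      ring
    · obtain ⟨i, rfl⟩ := Fin.exists_succ_eq.2 hi
      obtain ⟨j, rfl⟩ := Fin.exists_succ_eq.2 hj
      rw [universalCoeff_succ_self_succ k n (ne_of_apply_ne Fin.succ hij),
        universalCoeff_zero_succ_self, universalCoeff_zero_zero_succ]
      convert Ideal.mul_mem_left _ (-2 * X (Sum.inr i)) (hmem i j) using 1
      simp only [hu]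
      ring
    · obtain ⟨l, rfl⟩ := Fin.exists_succ_eq.2 (hi.trans (hij.trans hjl)).ne'
      obtain ⟨j, rfl⟩ := Fin.exists_succ_eq.2 (hi.trans hij).ne'
      obtain ⟨i, rfl⟩ := Fin.exists_succ_eq.2 hi.ne'
      rw [Fin.succ_lt_succ_iff] at hij hjl
      rw [universalCoeff_succ_succ_succ k n hij.ne (hij.trans hjl).ne hjl.ne,
        universalCoeff_zero_succ_succ k n hij.ne, universalCoeff_zero_zero_succ]
      convert Ideal.add_mem _ (Ideal.mul_mem_left _ (-2 * X (Sum.inr j)) (hmem i l))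
        (Ideal.mul_mem_left _ (-2 * X (Sum.inr i)) (hmem j l)) using 1
      simp only [hu]
      ring
  · rw [sq, Ideal.span_mul_span', Ideal.span_le]
    rintro _ ⟨_, ⟨i, rfl⟩, _, ⟨j, rfl⟩, rfl⟩
    rw [SetLike.mem_coe]
    dsimp only
    have htwo : (C (2⁻¹ : k) : MvPolynomial (Fin n ⊕ Fin n) k) * 2 = 1 := by
      rw [← map_ofNat C 2, ← C_mul, inv_mul_cancel₀ two_ne_zero, C_1]
    wlog hij : i ≤ j generalizing i j
    · simpa only [mul_comm] using this j i (le_of_not_ge hij)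
    rcases hij.eq_or_lt with rfl | hij
    · have h : u i * u i = -1 * (3 * universalCoeff k n 0 i.succ i.succ -
          universalCoeff k n 0 0 i.succ ^ 2) := by
        rw [universalCoeff_zero_succ_self, universalCoeff_zero_zero_succ]
        simp only [hu]
        ring
      rw [h]
      exact Ideal.mul_mem_left _ _
        (Ideal.subset_span (Or.inl ⟨i.succ, Fin.succ_ne_zero i, rfl⟩))
    · have h : u i * u j = -C (2⁻¹ : k) * (3 * universalCoeff k n 0 i.succ j.succ -
          2 * universalCoeff k n 0 0 i.succ * universalCoeff k n 0 0 j.succ) := by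
        rw [universalCoeff_zero_succ_succ k n hij.ne, universalCoeff_zero_zero_succ,
          universalCoeff_zero_zero_succ]
        simp only [hu]
        linear_combination
          (-(X (Sum.inl i) - X (Sum.inr i)) * (X (Sum.inl j) - X (Sum.inr j))) * htwo
      rw [h]
      exact Ideal.mul_mem_left _ _ (Ideal.subset_span (Or.inr (Or.inl
        ⟨i.succ, j.succ, Fin.succ_pos i, Fin.succ_lt_succ_iff.2 hij, rfl⟩)))
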